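/- arXiv:2204.01481 — 2 statements merged into one kernel-verified Lean document; each statement's English description precedes it below -/
import Mathlib

section
/- If f(x,y) is an irreducible polynomial in two variables with algebraic coefficients, then the entire function F(x) = f(x, e^{ix}) has no multiple root other than possibly x = 0; that is, F and F' have no common zero in ℂ \ {0}. -/
/-- The field of algebraic numbers: the integral closure of `ℚ` in `ℂ`. -/
noncomputable abbrev AlgNum : Subalgebra ℚ ℂ := integralClosure ℚ ℂ

/-- Evaluate a bivariate polynomial with algebraic coefficients at `(x, e^{ix})`. -/
noncomputable def evalExp (f : MvPolynomial (Fin 2) AlgNum) (x : ℂ) : ℂ :=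
  MvPolynomial.eval ![x, Complex.exp (Complex.I * x)]
    (MvPolynomial.map (algebraMap AlgNum ℂ) f)

open Complex
open scoped Polynomial

theorem isIntegral_leadingCoeff_pow_smul_aeval {K : Type*} [CommRing K] {f : Polynomial ℤ} {x : K}
    (hx : Polynomial.aeval x f = 0) (g : Polynomial ℤ) {N : ℕ} (hN : g.natDegree ≤ N) :
    IsIntegral ℤ (f.leadingCoeff ^ N • Polynomial.aeval x g) := by
  rw [Polynomial.aeval_eq_sum_range' (Nat.lt_succ_of_le hN), Finset.smul_sum]
  refine IsIntegral.sum _ fun k hk ↦ ?_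
  have hk : k ≤ N := by simpa [Nat.lt_succ_iff] using hk
  have : f.leadingCoeff ^ N • g.coeff k • x ^ k =
      (f.leadingCoeff ^ (N - k) * g.coeff k) • (f.leadingCoeff • x) ^ k := by
    rw [smul_pow, smul_smul, smul_smul, mul_right_comm, ← pow_add, Nat.sub_add_cancel hk]
  rw [this]
  exact ((isIntegral_leadingCoeff_smul f x hx).pow k).smul _

theorem exists_int_eq_of_isIntegral_of_forall_fixed {K : Type*} [Field K] [NumberField K]
    [IsGalois ℚ K] {x : K} (hx : IsIntegral ℤ x) (hfix : ∀ σ : Gal(K/ℚ), σ x = x) :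
    ∃ z : ℤ, (z : K) = x := by
  obtain ⟨q, rfl⟩ := IntermediateField.mem_bot.1 ((IsGalois.mem_bot_iff_fixed x).2 hfix)
  rw [isIntegral_algebraMap_iff (algebraMap ℚ K).injective] at hx
  obtain ⟨z, rfl⟩ := IsIntegrallyClosed.isIntegral_iff.1 hx
  exact ⟨z, by simp⟩

theorem exists_intPoly_forall_aeval_eq_zero {K : Type*} [Field K] [CharZero K]
    [Algebra.IsAlgebraic ℚ K] (S : Finset K) (hS : 0 ∉ S) :
    ∃ f : Polynomial ℤ, f.eval 0 ≠ 0 ∧ ∀ x ∈ S, Polynomial.aeval x f = 0 := by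
  have h (x : S) : ∃ q : Polynomial ℤ, q.coeff 0 ≠ 0 ∧ Polynomial.aeval (x : K) q = 0 := by
    have hx : IsAlgebraic ℤ (x : K) :=
      (IsFractionRing.isAlgebraic_iff ℤ ℚ K).2 (Algebra.IsAlgebraic.isAlgebraic _)
    exact hx.exists_nonzero_coeff_and_aeval_eq_zero
      (mem_nonZeroDivisors_of_ne_zero fun h ↦ hS (h ▸ x.2))
  choose q hq0 hq using h
  refine ⟨∏ x, q x, ?_, fun x hx ↦ ?_⟩
  · rw [Polynomial.eval_prod, Finset.prod_ne_zero_iff]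
    exact fun x _ ↦ by simpa [Polynomial.coeff_zero_eq_eval_zero] using hq0 x
  · rw [map_prod]
    exact Finset.prod_eq_zero (Finset.mem_univ ⟨x, hx⟩) (hq ⟨x, hx⟩)

theorem eventually_mul_pow_div_factorial_pred_lt_one (A C : ℝ) :
    ∀ᶠ p : ℕ in Filter.atTop, A * (C ^ p / (p - 1).factorial) < 1 := by
  have h := ((FloorSemiring.tendsto_pow_div_factorial_atTop C).const_mul (A * C)).comp
    (Filter.tendsto_sub_atTop_nat 1)
  rw [mul_zero] at h
  filter_upwards [h.eventually_lt_const one_pos, Filter.eventually_ge_atTop 1] with p hp h1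
  convert! hp using 1
  obtain ⟨k, rfl⟩ := Nat.exists_eq_add_of_le' h1
  simp [pow_succ]
  ring

theorem sum_mul_exp_ne_zero_of_galois_invariant {K : Type*} [Field K] [NumberField K]
    [IsGalois ℚ K] (φ : K →+* ℂ) (s : K →₀ ℤ) (hs : ∀ (σ : Gal(K/ℚ)) (x : K), s (σ x) = s x)
    (h0 : s 0 ≠ 0) : ∑ x ∈ s.support, (s x : ℂ) * exp (φ x) ≠ 0 := by
  classical
  intro hsum
  set S := s.support.erase 0
  obtain ⟨f, hf0, hf⟩ := exists_intPoly_forall_aeval_eq_zero S (by simp [S])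
  have hfne : f ≠ 0 := by rintro rfl; simp at hf0
  obtain ⟨c, hc⟩ := LindemannWeierstrass.exp_polynomial_approx f hf0
  set l := f.leadingCoeff
  have hl : l ≠ 0 := Polynomial.leadingCoeff_ne_zero.2 hfne
  set A : ℝ := ∑ x ∈ S, ‖(s x : ℂ)‖
  obtain ⟨p, hprime, hpf, hpl, hps, hp1⟩ : ∃ p : ℕ, p.Prime ∧ (f.eval 0).natAbs < p ∧
      l.natAbs < p ∧ (s 0).natAbs < p ∧
      A * ((‖(l : ℂ)‖ ^ f.natDegree * c) ^ p / (p - 1).factorial) < 1 := by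
    obtain ⟨a, ha⟩ := Filter.eventually_atTop.1 <|
      eventually_mul_pow_div_factorial_pred_lt_one A (‖(l : ℂ)‖ ^ f.natDegree * c)
    obtain ⟨p, hp, hprime⟩ := Nat.exists_infinite_primes
      (a + (f.eval 0).natAbs + l.natAbs + (s 0).natAbs + 1)
    exact ⟨p, hprime, by lia, by lia, by lia, ha p (by lia)⟩
  obtain ⟨n, hn, g, hg, happrox⟩ := hc p hpf hprime
  have hpZ : Prime (p : ℤ) := Nat.prime_iff_prime_int.1 hprime
  have hndvd {z : ℤ} (hz : z ≠ 0) (h : z.natAbs < p) : ¬ (p : ℤ) ∣ z := fun hd ↦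
    h.not_ge (Nat.le_of_dvd (Int.natAbs_pos.2 hz) (Int.natCast_dvd.1 hd))
  obtain ⟨z, hz⟩ : ∃ z : ℤ, (z : K) =
      ∑ x ∈ S, s x • (l ^ (p * f.natDegree) • Polynomial.aeval x g) := by
    refine exists_int_eq_of_isIntegral_of_forall_fixed (IsIntegral.sum _ fun x hx ↦
      (isIntegral_leadingCoeff_pow_smul_aeval (hf x hx) g (by lia)).smul _) fun σ ↦ ?_
    rw [map_sum]
    refine Finset.sum_equiv σ.toEquiv (fun x ↦ ?_) fun x hx ↦ ?_
    · simp [S, hs]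
    · have := Polynomial.aeval_algHom_apply (σ.toAlgHom.restrictScalars ℤ) x g
      simp at this
      simp [hs, this]
  have hz' : (z : ℂ) = (l : ℂ) ^ (p * f.natDegree) *
      ∑ x ∈ S, (s x : ℂ) * Polynomial.aeval (φ x) g := by
    have h := congrArg φ hz
    rw [map_intCast, map_sum] at h
    rw [h, Finset.mul_sum]
    refine Finset.sum_congr rfl fun x _ ↦ ?_
    have := Polynomial.aeval_algHom_apply φ.toIntAlgHom x g
    simp at this
    simp [this]
    ring
  have hsum' : (s 0 : ℂ) + ∑ x ∈ S, (s x : ℂ) * exp (φ x) = 0 := by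
    rw [← hsum, ← Finset.add_sum_erase _ _ (Finsupp.mem_support_iff.2 h0)]
    simp [S]
  set m : ℤ := l ^ (p * f.natDegree) * (n * s 0) + p * z with hm
  have hpm : ¬ (p : ℤ) ∣ m := by
    rw [hm, Int.dvd_add_left (dvd_mul_right _ _), hpZ.dvd_mul, hpZ.dvd_mul]
    rintro (h | h | h)
    · exact hndvd hl hpl (hpZ.dvd_of_dvd_pow h)
    · exact hn h
    · exact hndvd h0 hps h
  have hmC : (m : ℂ) = -(l : ℂ) ^ (p * f.natDegree) *
      ∑ x ∈ S, (s x : ℂ) * (n • exp (φ x) - p • Polynomial.aeval (φ x) g) := by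
    simp only [hm, mul_sub, Finset.sum_sub_distrib]
    push_cast
    have h1 : ∑ x ∈ S, (s x : ℂ) * n • exp (φ x) = n * ∑ x ∈ S, (s x : ℂ) * exp (φ x) := by
      rw [Finset.mul_sum]; exact Finset.sum_congr rfl fun x _ ↦ by simp; ring
    have h2 : ∑ x ∈ S, (s x : ℂ) * p • Polynomial.aeval (φ x) g =
        p * ∑ x ∈ S, (s x : ℂ) * Polynomial.aeval (φ x) g := by
      rw [Finset.mul_sum]; exact Finset.sum_congr rfl fun x _ ↦ by simp; ring
    rw [h1, h2, hz']
    linear_combination (l : ℂ) ^ (p * f.natDegree) * n * hsum'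
  have hlt : ‖(m : ℂ)‖ < 1 := by
    refine lt_of_le_of_lt ?_ hp1
    rw [hmC, norm_mul, norm_neg, norm_pow, mul_pow, ← pow_mul, mul_comm f.natDegree p, mul_div_assoc,
      mul_left_comm]
    refine mul_le_mul_of_nonneg_left ?_ (by positivity)
    rw [Finset.sum_mul]
    refine (norm_sum_le _ _).trans (Finset.sum_le_sum fun x hx ↦ ?_)
    rw [norm_mul]
    refine mul_le_mul_of_nonneg_left (happrox ?_) (norm_nonneg _)
    rw [Polynomial.mem_aroots]
    refine ⟨hfne, ?_⟩
    have := Polynomial.aeval_algHom_apply φ.toIntAlgHom x f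
    rw [hf x hx, map_zero] at this
    simpa using this
  rw [Complex.norm_intCast] at hlt
  have : m = 0 := Int.abs_lt_one_iff.1 (by exact_mod_cast hlt)
  exact hpm (this ▸ dvd_zero _)

section
variable {K : Type*} [Field K]

/-- The evaluation `ℤ[K] → ℂ` sending the basis element of `x` to `exp (φ x)`. -/
noncomputable def expEval (φ : K →+* ℂ) : AddMonoidAlgebra ℤ K →ₐ[ℤ] ℂ :=
  AddMonoidAlgebra.lift ℤ ℂ K (expMonoidHom.comp (AddMonoidHom.toMultiplicative φ.toAddMonoidHom))

theorem expEval_eq_sum (φ : K →+* ℂ) (a : AddMonoidAlgebra ℤ K) :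
    expEval φ a = ∑ x ∈ a.coeff.support, (a.coeff x : ℂ) * exp (φ x) := by
  simp [expEval, AddMonoidAlgebra.lift_apply, Finsupp.sum]

variable [NumberField K]

/-- The action of the Galois group on the group ring `ℤ[K]` of the additive group of `K`. -/
noncomputable def galoisActGroupRing (σ : Gal(K/ℚ)) : AddMonoidAlgebra ℤ K ≃+*
    AddMonoidAlgebra ℤ K :=
  AddMonoidAlgebra.mapDomainRingEquiv ℤ σ.toRingEquiv.toAddEquiv

theorem coeff_galoisActGroupRing (σ : Gal(K/ℚ)) (a : AddMonoidAlgebra ℤ K) (x : K) :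
    (galoisActGroupRing σ a).coeff x = a.coeff (σ.symm x) := by
  simp [galoisActGroupRing, Finsupp.equivMapDomain_apply]

theorem galoisActGroupRing_mul_apply (σ τ : Gal(K/ℚ)) (a : AddMonoidAlgebra ℤ K) :
    galoisActGroupRing (σ * τ) a = galoisActGroupRing σ (galoisActGroupRing τ a) := by
  ext x
  simp only [coeff_galoisActGroupRing]
  rfl

theorem galoisActGroupRing_one_apply (a : AddMonoidAlgebra ℤ K) :
    galoisActGroupRing (1 : Gal(K/ℚ)) a = a := by
  ext x
  simp only [coeff_galoisActGroupRing]
  rfl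

theorem galoisActGroupRing_prod (σ : Gal(K/ℚ)) (a : AddMonoidAlgebra ℤ K) :
    galoisActGroupRing σ (∏ τ : Gal(K/ℚ), galoisActGroupRing τ a) =
      ∏ τ : Gal(K/ℚ), galoisActGroupRing τ a := by
  simp only [map_prod, ← galoisActGroupRing_mul_apply]
  exact Equiv.prod_comp (Equiv.mulLeft σ) fun τ ↦ galoisActGroupRing τ a

theorem galoisActGroupRing_sum (σ : Gal(K/ℚ)) (a : AddMonoidAlgebra ℤ K) :
    galoisActGroupRing σ (∑ τ : Gal(K/ℚ), galoisActGroupRing τ a) =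
      ∑ τ : Gal(K/ℚ), galoisActGroupRing τ a := by
  simp only [map_sum, ← galoisActGroupRing_mul_apply]
  exact Equiv.sum_comp (Equiv.mulLeft σ) fun τ ↦ galoisActGroupRing τ a

theorem expEval_ne_zero [IsGalois ℚ K] (φ : K →+* ℂ) {a : AddMonoidAlgebra ℤ K} (ha : a ≠ 0) :
    expEval φ a ≠ 0 := by
  classical
  intro h
  set N := ∏ τ : Gal(K/ℚ), galoisActGroupRing τ a with hN
  have hN0 : N ≠ 0 := Finset.prod_ne_zero_iff.2 fun τ _ ↦ by simpa using ha
  have hNinv (σ : Gal(K/ℚ)) (x : K) : N.coeff (σ x) = N.coeff x := by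
    conv_lhs => rw [hN, ← galoisActGroupRing_prod σ, coeff_galoisActGroupRing]
    simp
    rfl
  obtain ⟨x₀, hx₀⟩ : ∃ x, N.coeff x ≠ 0 := by
    by_contra! h
    exact hN0 (AddMonoidAlgebra.coeff_injective (Finsupp.ext h))
  set M := ∑ τ : Gal(K/ℚ), galoisActGroupRing τ (AddMonoidAlgebra.single (-x₀) 1) with hM
  refine sum_mul_exp_ne_zero_of_galois_invariant φ (N * M).coeff (fun σ x ↦ ?_) ?_ ?_
  · conv_lhs => rw [hN, hM, ← galoisActGroupRing_prod σ, ← galoisActGroupRing_sum σ, ← map_mul,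
      coeff_galoisActGroupRing]
    simp
    rfl
  · have : (N * M).coeff 0 = ∑ τ : Gal(K/ℚ), N.coeff x₀ := by
      rw [hM, Finset.mul_sum, AddMonoidAlgebra.coeff_sum, Finsupp.finsetSum_apply]
      refine Finset.sum_congr rfl fun τ _ ↦ ?_
      have h1 : galoisActGroupRing τ (AddMonoidAlgebra.single (-x₀) 1) =
          AddMonoidAlgebra.single (-τ x₀) 1 := by
        simp [galoisActGroupRing]
      have h2 := AddMonoidAlgebra.coeff_mul_single_add N 1 (-τ x₀) (τ x₀)
      rw [add_neg_cancel, mul_one, hNinv] at h2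
      rw [h1, h2]
    rw [this]
    simpa using hx₀
  · rw [← expEval_eq_sum, map_mul, hN, map_prod,
      Finset.prod_eq_zero (Finset.mem_univ 1) (by rw [galoisActGroupRing_one_apply, h]), zero_mul]

theorem transcendental_exp_of_isGalois [IsGalois ℚ K] (φ : K →+* ℂ) {α : K} (hα : α ≠ 0) :
    Transcendental ℤ (exp (φ α)) := by
  classical
  rw [transcendental_iff]
  intro p hp
  by_contra hp0
  set a : AddMonoidAlgebra ℤ K := Polynomial.aeval (AddMonoidAlgebra.single α 1) p with ha
  have hcoeff (k : ℕ) : a.coeff (k • α) = p.coeff k := by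
    have hinj : Function.Injective fun k : ℕ ↦ k • α := fun i j h ↦ by simpa [hα] using h
    rw [ha, Polynomial.aeval_eq_sum_range, AddMonoidAlgebra.coeff_sum, Finsupp.finsetSum_apply]
    simp only [AddMonoidAlgebra.single_pow, one_pow, AddMonoidAlgebra.coeff_smul_apply,
      AddMonoidAlgebra.coeff_single]
    simp only [Finsupp.single_apply, hinj.eq_iff]
    simp only [Finset.sum_ite_eq', smul_eq_mul, mul_ite, mul_one, mul_zero, Finset.mem_range,
      ite_eq_left_iff, not_lt]
    intro h
    exact (Polynomial.coeff_eq_zero_of_natDegree_lt h).symm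
  refine expEval_ne_zero φ (a := a) (fun h ↦ hp0 ?_) ?_
  · ext k
    rw [← hcoeff, h]
    simp
  · rw [ha, ← Polynomial.aeval_algHom_apply, ← hp]
    simp [expEval]
end

/-- **Hermite–Lindemann theorem**. -/
theorem transcendental_exp {α : ℂ} (hα : IsAlgebraic ℚ α) (h0 : α ≠ 0) :
    Transcendental ℚ (exp α) := by
  let K := IntermediateField.adjoin ℚ ((minpoly ℚ α).rootSet ℂ)
  have : (minpoly ℚ α).IsSplittingField ℚ K :=
    IntermediateField.adjoin_rootSet_isSplittingField (IsAlgClosed.splits _)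
  have : IsGalois ℚ K := .of_separable_splitting_field (minpoly.irreducible hα.isIntegral).separable
  have : FiniteDimensional ℚ K := Polynomial.IsSplittingField.finiteDimensional K (minpoly ℚ α)
  have : NumberField K := {}
  have hαK : α ∈ K := IntermediateField.subset_adjoin _ _ <|
    Polynomial.mem_rootSet.2 ⟨minpoly.ne_zero hα.isIntegral, minpoly.aeval ℚ α⟩
  have h := transcendental_exp_of_isGalois (algebraMap K ℂ) (α := ⟨α, hαK⟩)
    (by simpa [Subtype.ext_iff] using h0)
  exact fun h' ↦ h ((IsFractionRing.isAlgebraic_iff ℤ ℚ ℂ).2 h')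

theorem Irreducible.dvd_of_eval₂_eq_zero {R F : Type*} [CommRing R] [IsDomain R]
    [UniqueFactorizationMonoid R] [Field F] {ψ : R →+* F} (hψ : Function.Injective ψ) {y : F}
    {f g : R[X]} (hf : Irreducible f) (hdeg : f.natDegree ≠ 0) (hfy : f.eval₂ ψ y = 0)
    (hgy : g.eval₂ ψ y = 0) : f ∣ g := by
  obtain ⟨_⟩ : Nonempty (NormalizedGCDMonoid R) := inferInstance
  set L := FractionRing R
  have hprim := hf.isPrimitive hdeg
  have hfL := (hprim.irreducible_iff_irreducible_map_fraction_map (K := L)).1 hf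
  refine hprim.dvd_of_fraction_map_dvd_fraction_map (K := L) ?_
  by_contra hdvd
  obtain ⟨u, v, huv⟩ := hfL.coprime_iff_not_dvd.2 hdvd
  have hlift : (IsFractionRing.lift hψ : L →+* F).comp (algebraMap R L) = ψ :=
    RingHom.ext fun r ↦ IsFractionRing.lift_algebraMap hψ r
  have := congrArg (Polynomial.eval₂ (IsFractionRing.lift hψ : L →+* F) y) huv
  simp [Polynomial.eval₂_add, Polynomial.eval₂_mul, Polynomial.eval₂_map, hlift, hfy, hgy] at this

theorem Polynomial.eq_zero_of_derivative_eq_mul {R : Type*} [CommRing R] [IsDomain R] {p q : R[X]}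
    (hp : p ≠ 0) (h : derivative p = p * q) : q = 0 := by
  by_contra hq
  have h1 := degree_derivative_lt hp
  rw [h, degree_mul] at h1
  exact h1.not_ge (le_add_of_nonneg_right (zero_le_degree_iff.2 hq))

section
variable {K : Type*} [CommRing K]

/-- The derivation of `K[X][Y]` with `X ↦ 1` and `Y ↦ j * Y`. -/
noncomputable def expDerivation (j : K) : Derivation K K[X][X] K[X][X] :=
  (PolynomialModule.equivPolynomialSelf (R := K[X])).toLinearMap.compDer
      (Polynomial.derivative' (R := K)).mapCoeffs +
    (Polynomial.C (Polynomial.C j) * Polynomial.X : K[X][X]) •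
      (Polynomial.derivative' (R := K[X])).restrictScalars K

theorem coeff_expDerivation (j : K) (f : K[X][X]) (k : ℕ) :
    (expDerivation j f).coeff k =
      Polynomial.derivative (f.coeff k) + Polynomial.C (k * j) * f.coeff k := by
  have h : (expDerivation j f).coeff k = Polynomial.derivative (f.coeff k) +
      (Polynomial.C (Polynomial.C j) * Polynomial.X * Polynomial.derivative f).coeff k := rfl
  rw [h, mul_assoc, Polynomial.coeff_C_mul]
  cases k with
  | zero => simp
  | succ k => rw [Polynomial.coeff_X_mul, Polynomial.coeff_derivative]; simp; ring

theorem expDerivation_monomial (j : K) (n : ℕ) (p : K[X]) :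
    expDerivation j (Polynomial.monomial n p) =
      Polynomial.monomial n (Polynomial.derivative p + Polynomial.C (n * j) * p) := by
  ext1 k
  rw [coeff_expDerivation, Polynomial.coeff_monomial, Polynomial.coeff_monomial]
  split_ifs with h <;> simp [h]

variable [Algebra K ℂ]

/-- Evaluation of `K[X][Y]` at `(x, exp (I * x))`. -/
noncomputable def polyExpEval (x : ℂ) : K[X][X] →+* ℂ :=
  Polynomial.eval₂RingHom (Polynomial.aeval x : K[X] →ₐ[K] ℂ).toRingHom (exp (I * x))

theorem polyExpEval_monomial (x : ℂ) (n : ℕ) (p : K[X]) :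
    polyExpEval x (Polynomial.monomial n p) = Polynomial.aeval x p * exp (I * x) ^ n := by
  simp [polyExpEval]

theorem polyExpEval_C (x : ℂ) (p : K[X]) :
    polyExpEval x (Polynomial.C p) = Polynomial.aeval x p := by
  simp [polyExpEval]

theorem hasDerivAt_polyExpEval {j : K} (hj : algebraMap K ℂ j = I) (f : K[X][X]) (x : ℂ) :
    HasDerivAt (fun x ↦ polyExpEval x f) (polyExpEval x (expDerivation j f)) x := by
  induction f using Polynomial.induction_on' with
  | add p q hp hq => simpa only [map_add] using hp.fun_add hq
  | monomial n p =>
    simp only [expDerivation_monomial, polyExpEval_monomial]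
    have h1 : HasDerivAt (fun x : ℂ ↦ exp (I * x) ^ n) (n * I * exp (I * x) ^ n) x := by
      simp only [← exp_nat_mul]
      convert! (((hasDerivAt_id x).const_mul I).const_mul (n : ℂ)).cexp using 1
      simp
      ring
    convert! (p.hasDerivAt_aeval x).mul h1 using 1
    simp [hj]
    ring

theorem not_polyExpEval_eq_zero_of_transcendental [IsDomain K] [CharZero K]
    [UniqueFactorizationMonoid K] {j : K} (hj : j ≠ 0) {f : K[X][X]} (hf : Irreducible f) {x : ℂ}
    (hx : Transcendental K x) :
    ¬ (polyExpEval x f = 0 ∧ polyExpEval x (expDerivation j f) = 0) := by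
  rintro ⟨h0, h1⟩
  have hinj := transcendental_iff_injective.1 hx
  have hdeg : f.natDegree ≠ 0 := by
    intro h
    rw [Polynomial.eq_C_of_natDegree_eq_zero h, polyExpEval_C] at h0
    refine hf.ne_zero ?_
    rw [Polynomial.eq_C_of_natDegree_eq_zero h, hinj (h0.trans (map_zero _).symm), map_zero]
  obtain ⟨c, hc⟩ := hf.dvd_of_eval₂_eq_zero hinj hdeg h0 h1
  have hcdeg : c.natDegree = 0 := by
    rcases eq_or_ne c 0 with rfl | hc0
    · simp
    have hle : (expDerivation j f).natDegree ≤ f.natDegree := by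
      rw [Polynomial.natDegree_le_iff_coeff_eq_zero]
      intro N hN
      simp [coeff_expDerivation, Polynomial.coeff_eq_zero_of_natDegree_lt hN]
    rw [hc, Polynomial.natDegree_mul hf.ne_zero hc0] at hle
    lia
  rw [Polynomial.eq_C_of_natDegree_eq_zero hcdeg] at hc
  have hcoeff (k : ℕ) : Polynomial.derivative (f.coeff k) =
      f.coeff k * (c.coeff 0 - Polynomial.C (k * j)) := by
    have := congrArg (Polynomial.coeff · k) hc
    simp only [coeff_expDerivation, Polynomial.coeff_mul_C] at this
    linear_combination this
  have htop := Polynomial.eq_zero_of_derivative_eq_mul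
    (by simpa using hf.ne_zero) (hcoeff f.natDegree)
  have hf0 : f.coeff 0 = 0 := by
    by_contra hf0
    have hbot := Polynomial.eq_zero_of_derivative_eq_mul hf0 (hcoeff 0)
    have : c.coeff 0 = 0 := by simpa using hbot
    simp [this, hdeg, hj] at htop
  obtain ⟨u, hu⟩ := Polynomial.X_dvd_iff.2 hf0
  have hunit := (hf.isUnit_or_isUnit hu).resolve_left Polynomial.not_isUnit_X
  rw [hu, map_mul] at h0
  refine mul_ne_zero ?_ (hunit.map (polyExpEval x)).ne_zero h0
  simp [polyExpEval]

theorem not_polyExpEval_eq_zero_of_transcendental_exp [IsDomain K] {j : K} {f : K[X][X]}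
    (hf : Irreducible f) {a : K} (ha : Transcendental K (exp (I * algebraMap K ℂ a))) :
    ¬ (polyExpEval (algebraMap K ℂ a) f = 0 ∧
      polyExpEval (algebraMap K ℂ a) (expDerivation j f) = 0) := by
  rintro ⟨h0, h1⟩
  have hmap : f.map (Polynomial.evalRingHom a) = 0 := by
    refine transcendental_iff.1 ha _ ?_
    rw [← h0, Polynomial.aeval_def, Polynomial.eval₂_map, polyExpEval,
      Polynomial.coe_eval₂RingHom]
    congr 1
    ext <;> simp
  have hdvd : Polynomial.C (Polynomial.X - Polynomial.C a) ∣ f := by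
    refine (Polynomial.C_dvd_iff_dvd_coeff _ _).2 fun k ↦ Polynomial.dvd_iff_isRoot.2 ?_
    simpa using congrArg (Polynomial.coeff · k) hmap
  obtain ⟨u, hu⟩ := hdvd
  have hunit := (hf.isUnit_or_isUnit hu).resolve_left fun h ↦
    Polynomial.not_isUnit_X_sub_C a (Polynomial.isUnit_C.1 h)
  refine (hunit.map (polyExpEval (algebraMap K ℂ a))).ne_zero ?_
  have hD : expDerivation j (Polynomial.C (Polynomial.X - Polynomial.C a)) = 1 := by
    rw [← Polynomial.monomial_zero_left, expDerivation_monomial]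
    simp
  rw [hu, Derivation.leibniz, hD] at h1
  simpa [polyExpEval_C] using h1

end

/-- The identification `K[x, y] ≃ K[x][y]`. -/
noncomputable def mvPolynomialFinTwoEquiv (K : Type*) [CommRing K] :
    MvPolynomial (Fin 2) K ≃ₐ[K] K[X][X] :=
  (MvPolynomial.renameEquiv K (Equiv.swap 0 1)).trans <| (MvPolynomial.finSuccEquiv K 1).trans <|
    Polynomial.mapAlgEquiv (MvPolynomial.uniqueAlgEquiv K (Fin 1))

theorem evalExp_eq_polyExpEval (f : MvPolynomial (Fin 2) AlgNum) (x : ℂ) :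
    evalExp f x = polyExpEval x (mvPolynomialFinTwoEquiv AlgNum f) := by
  have : (MvPolynomial.eval ![x, exp (I * x)]).comp (MvPolynomial.map (algebraMap AlgNum ℂ)) =
      (polyExpEval x).comp (mvPolynomialFinTwoEquiv AlgNum).toRingEquiv.toRingHom := by
    refine MvPolynomial.ringHom_ext (fun r ↦ ?_) (Fin.forall_fin_two.2 ⟨?_, ?_⟩)
    · have hC : mvPolynomialFinTwoEquiv AlgNum (MvPolynomial.C r) =
          Polynomial.C (Polynomial.C r) :=
        (mvPolynomialFinTwoEquiv AlgNum).commutes r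
      simp [hC, polyExpEval]
    · have hX : MvPolynomial.finSuccEquiv AlgNum 1 (MvPolynomial.X 1) =
          Polynomial.C (MvPolynomial.X 0) :=
        MvPolynomial.finSuccEquiv_X_succ (j := 0)
      simp [polyExpEval, mvPolynomialFinTwoEquiv, hX]
    · have hX : MvPolynomial.finSuccEquiv AlgNum 1 (MvPolynomial.X 0) = Polynomial.X :=
        MvPolynomial.finSuccEquiv_X_zero
      simp [polyExpEval, mvPolynomialFinTwoEquiv, hX]
  exact DFunLike.congr_fun this f

theorem isField_algNum : IsField AlgNum :=
  isField_of_isIntegral_of_isField' (Field.toIsField ℚ)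

theorem uniqueFactorizationMonoid_algNum : UniqueFactorizationMonoid AlgNum := by
  let _ := isField_algNum.toField
  infer_instance

theorem stmt_2 (f : MvPolynomial (Fin 2) AlgNum) (hirr : Irreducible f) :
    ∀ x : ℂ, x ≠ 0 → ¬(evalExp f x = 0 ∧ deriv (evalExp f) x = 0) := by
  intro x hx
  have hI : IsIntegral ℚ I := Complex.isIntegral_rat_I
  have := uniqueFactorizationMonoid_algNum
  let j : AlgNum := ⟨I, hI⟩
  have hjI : algebraMap AlgNum ℂ j = I := rfl
  have hj0 : j ≠ 0 := by rintro h; rw [h] at hjI; simp [eq_comm] at hjI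
  have hf := (MulEquiv.irreducible_iff (mvPolynomialFinTwoEquiv AlgNum)).2 hirr
  rw [funext (evalExp_eq_polyExpEval f), (hasDerivAt_polyExpEval hjI _ x).deriv]
  by_cases halg : Transcendental AlgNum x
  · exact not_polyExpEval_eq_zero_of_transcendental hj0 hf halg
  · have hxQ : IsAlgebraic ℚ x := IsAlgebraic.restrictScalars ℚ (not_not.1 halg)
    have hexp := transcendental_exp ((IsIntegral.isAlgebraic hI).mul hxQ) (mul_ne_zero I_ne_zero hx)
    exact not_polyExpEval_eq_zero_of_transcendental_exp (a := ⟨x, hxQ.isIntegral⟩) hf fun h ↦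
      hexp (IsAlgebraic.restrictScalars ℚ h)
end

section
/- If f(x,y) ∈ A[x,y] is square-free (has no repeated irreducible factor), then F(x) = f(x, e^{ix}) has no multiple root other than possibly x = 0. -/
open Polynomial

theorem exists_prime_mul_pow_div_factorial_lt_one (B M : ℝ) (N : ℕ) :
    ∃ p : ℕ, N < p ∧ p.Prime ∧ B * (M ^ p / (p - 1).factorial) < 1 := by
  have h := (FloorSemiring.tendsto_pow_div_factorial_atTop M).const_mul (B * M)
  rw [mul_zero] at h
  obtain ⟨N', hN'⟩ := Filter.eventually_atTop.1 (h.eventually (gt_mem_nhds one_pos))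
  obtain ⟨p, hp, hpp⟩ := Nat.exists_infinite_primes (N + N' + 1)
  refine ⟨p, by omega, hpp, ?_⟩
  have := hN' (p - 1) (by omega)
  obtain ⟨q, rfl⟩ : ∃ q, p = q + 1 := ⟨p - 1, by omega⟩
  simp only [Nat.add_sub_cancel] at this ⊢
  rwa [pow_succ', mul_div_assoc, ← mul_assoc]

theorem isIntegral_pow_smul_aeval {K : Type*} [CommRing K] {a : ℤ} {e : K}
    (h : IsIntegral ℤ (a • e)) {g : ℤ[X]} {N : ℕ} (hg : g.natDegree ≤ N) :
    IsIntegral ℤ (a ^ N • aeval e g) := by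
  rw [aeval_eq_sum_range, Finset.smul_sum]
  refine IsIntegral.sum _ fun i hi ↦ ?_
  have hi : i ≤ N := by grind
  have : a ^ N • g.coeff i • e ^ i = (a ^ (N - i) * g.coeff i) • (a • e) ^ i := by
    rw [_root_.smul_pow, smul_smul, smul_smul, ← Nat.sub_add_cancel hi, Nat.add_sub_cancel, pow_add]
    ring_nf
  rw [this]
  exact (h.pow i).smul _

theorem exists_int_polynomial_aeval_eq_zero {K : Type*} [Field K] [Algebra ℚ K]
    [FiniteDimensional ℚ K] (s : Finset K) (hs : 0 ∉ s) :
    ∃ f : ℤ[X], f.eval 0 ≠ 0 ∧ ∀ e ∈ s, aeval e f = 0 := by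
  have h (e : K) (he : e ≠ 0) : ∃ q : ℤ[X], q.eval 0 ≠ 0 ∧ aeval e q = 0 := by
    have : IsAlgebraic ℤ e :=
      (IsFractionRing.isAlgebraic_iff ℤ ℚ K).2 (Algebra.IsAlgebraic.isAlgebraic e)
    obtain ⟨q, hq, hq'⟩ := this.exists_nonzero_coeff_and_aeval_eq_zero
      (mem_nonZeroDivisors_of_ne_zero he)
    exact ⟨q, by rwa [← coeff_zero_eq_eval_zero], hq'⟩
  choose! q hq hq' using h
  refine ⟨∏ e ∈ s, q e, ?_, fun e he ↦ ?_⟩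
  · rw [eval_prod, Finset.prod_ne_zero_iff]
    exact fun e he ↦ hq e (by rintro rfl; exact hs he)
  · rw [map_prod]
    exact Finset.prod_eq_zero he (hq' e (by rintro rfl; exact hs he))

/-- A Galois-invariant integer combination of exponentials of nonzero elements of a Galois number
field is not a nonzero integer. -/
theorem int_add_sum_exp_ne_zero {K : Type*} [Field K] [Algebra ℚ K] [FiniteDimensional ℚ K]
    [IsGalois ℚ K] (φ : K →+* ℂ) (s : Finset K) (hs : 0 ∉ s) (c : K → ℤ)
    (hσs : ∀ σ : Gal(K/ℚ), ∀ e ∈ s, σ e ∈ s) (hσc : ∀ (σ : Gal(K/ℚ)) e, c (σ e) = c e)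
    {w : ℤ} (hw : w ≠ 0) : (w : ℂ) + ∑ e ∈ s, c e * Complex.exp (φ e) ≠ 0 := by
  intro h
  obtain ⟨f, hf, hfs⟩ := exists_int_polynomial_aeval_eq_zero s hs
  have hf0 : f ≠ 0 := by rintro rfl; simp at hf
  obtain ⟨a, ha, has⟩ := exists_integral_multiples ℤ ℚ s
  obtain ⟨b, hb⟩ := LindemannWeierstrass.exp_polynomial_approx f hf
  set D := f.natDegree
  obtain ⟨p, hpN, hp, hlt⟩ := exists_prime_mul_pow_div_factorial_lt_one
    (∑ e ∈ s, |(c e : ℝ)|) (|(a : ℝ)| ^ D * |b|)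
    ((f.eval 0).natAbs + a.natAbs + w.natAbs)
  obtain ⟨n, hn, g, hgd, hg⟩ := hb p (by omega) hp
  have hgN : g.natDegree ≤ p * D := hgd.trans (Nat.sub_le _ _)
  have hroot (e : K) (he : e ∈ s) : φ e ∈ f.aroots ℂ := by
    rw [mem_aroots]
    refine ⟨hf0, ?_⟩
    have := congrArg φ (hfs e he)
    rwa [map_zero, ← RingHom.toIntAlgHom_apply, ← aeval_algHom_apply] at this
  obtain ⟨z, hz⟩ : ∃ z : ℤ, (z : K) = a ^ (p * D) • ∑ e ∈ s, c e • aeval e g := by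
    set S := ∑ e ∈ s, c e • aeval e g
    have hS : S ∈ Set.range (algebraMap ℚ K) := by
      rw [IsGalois.mem_range_algebraMap_iff_fixed]
      intro σ
      rw [map_sum]
      refine Finset.sum_nbij σ (hσs σ) σ.injective.injOn (fun e he ↦ ?_) fun e he ↦ ?_
      · exact ⟨σ.symm e, hσs σ.symm e he, by simp⟩
      · rw [hσc, map_zsmul, ← AlgEquiv.coe_toAlgHom, ← AlgHom.restrictScalars_apply ℤ,
          ← aeval_algHom_apply]
        rfl
    obtain ⟨r, hr⟩ := hS
    have h_integral : IsIntegral ℤ (a ^ (p * D) • S) := by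
      rw [Finset.smul_sum]
      refine IsIntegral.sum _ fun e he ↦ ?_
      rw [smul_comm]
      exact (isIntegral_pow_smul_aeval (has e he) hgN).smul _
    rw [← hr, ← map_zsmul, isIntegral_algebraMap_iff (algebraMap ℚ K).injective,
      IsIntegrallyClosed.isIntegral_iff] at h_integral
    obtain ⟨z, hz⟩ := h_integral
    refine ⟨z, ?_⟩
    rw [← hr, ← map_zsmul, ← hz]
    simp
  have hzC : (z : ℂ) = a ^ (p * D) * ∑ e ∈ s, c e * aeval (φ e) g := by
    have := congrArg φ hz
    rw [map_intCast, map_zsmul, map_sum] at this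
    rw [this, zsmul_eq_mul]
    push_cast
    congr 1
    refine Finset.sum_congr rfl fun e _ ↦ ?_
    rw [map_zsmul, zsmul_eq_mul, ← RingHom.toIntAlgHom_apply, ← aeval_algHom_apply]
    rfl
  set m : ℤ := a ^ (p * D) * n * w + p * z with hm
  have hm0 : m ≠ 0 := by
    intro h0
    have hdvd : (p : ℤ) ∣ a ^ (p * D) * n * w := by
      rw [← Int.dvd_add_left (dvd_mul_right (p : ℤ) z), ← hm, h0]
      exact dvd_zero _
    have hpZ := Nat.prime_iff_prime_int.1 hp
    rcases hpZ.dvd_or_dvd hdvd with h1 | h1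
    · rcases hpZ.dvd_or_dvd h1 with h2 | h2
      · have := Int.natAbs_dvd_natAbs.2 (hpZ.dvd_of_dvd_pow h2)
        have := Nat.le_of_dvd (by omega) this
        simp at this
        omega
      · exact hn h2
    · have := Nat.le_of_dvd (by omega) (Int.natAbs_dvd_natAbs.2 h1)
      simp at this
      omega
  have hmC : (m : ℂ) = -(a ^ (p * D) *
      ∑ e ∈ s, c e * (n • Complex.exp (φ e) - p • aeval (φ e) g)) := by
    have hsum : ∑ e ∈ s, c e * (n • Complex.exp (φ e) - p • aeval (φ e) g) =
        n * ∑ e ∈ s, c e * Complex.exp (φ e) - p * ∑ e ∈ s, c e * aeval (φ e) g := by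
      rw [Finset.mul_sum, Finset.mul_sum, ← Finset.sum_sub_distrib]
      refine Finset.sum_congr rfl fun e _ ↦ ?_
      rw [zsmul_eq_mul, nsmul_eq_mul]
      ring
    rw [hsum, hm]
    push_cast
    rw [hzC]
    linear_combination (a : ℂ) ^ (p * D) * n * h
  have hnorm : ‖(m : ℂ)‖ < 1 := by
    refine lt_of_le_of_lt ?_ hlt
    rw [hmC, norm_neg, norm_mul, norm_pow, Complex.norm_intCast, mul_pow, ← pow_mul, mul_comm D p,
      mul_div_assoc, mul_left_comm]
    refine mul_le_mul_of_nonneg_left ?_ (by positivity)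
    rw [Finset.sum_mul]
    refine (norm_sum_le _ _).trans (Finset.sum_le_sum fun e he ↦ ?_)
    rw [norm_mul, Complex.norm_intCast]
    refine mul_le_mul_of_nonneg_left ((hg (hroot e he)).trans ?_) (abs_nonneg _)
    rw [← abs_pow]
    gcongr
    exact le_abs_self _
  rw [Complex.norm_intCast] at hnorm
  have : |m| < 1 := by exact_mod_cast hnorm
  exact hm0 (Int.abs_lt_one_iff.1 this)

/-- The evaluation of the group ring `ℤ[K]` sending the formal exponent `e` to `exp (φ e)` does not
vanish on nonzero Galois-invariant elements. -/
theorem lift_exp_ne_zero_of_fixed {K : Type*} [Field K] [Algebra ℚ K] [FiniteDimensional ℚ K]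
    [IsGalois ℚ K] (φ : K →+* ℂ) (E : AddMonoidAlgebra ℤ K →+* ℂ)
    (hE : ∀ e n, E (.single e n) = n * Complex.exp (φ e)) {h : AddMonoidAlgebra ℤ K} (h0 : h ≠ 0)
    (hh : ∀ (σ : Gal(K/ℚ)) e, h.coeff (σ e) = h.coeff e) : E h ≠ 0 := by
  classical
  intro hEh
  let ν := AddMonoidAlgebra.mapDomainRingEquiv ℤ (AddEquiv.neg K)
  have hν (e : K) : (ν h).coeff e = h.coeff (-e) := by
    rw [AddMonoidAlgebra.coeff_mapDomainRingEquiv]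
    rfl
  set H := h * ν h
  have hEH : E H = 0 := by rw [map_mul, hEh, zero_mul]
  have hw : H.coeff 0 ≠ 0 := by
    have : H.coeff 0 = ∑ e ∈ h.coeff.support, h.coeff e ^ 2 := by
      rw [AddMonoidAlgebra.coeff_mul]
      refine Finset.sum_congr rfl fun e _ ↦ ?_
      refine (Finset.sum_eq_single (-e) ?_ ?_).trans ?_
      · exact fun m _ hm ↦ if_neg fun h ↦ hm (neg_eq_of_add_eq_zero_right h).symm
      · intro he
        beta_reduce
        rw [Finsupp.notMem_support_iff.1 he, mul_zero, ite_self]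
      · beta_reduce
        rw [if_pos (add_neg_cancel e), hν, neg_neg, sq]
    rw [this]
    refine (Finset.sum_pos (fun e he ↦ ?_) ?_).ne'
    · have := Finsupp.mem_support_iff.1 he
      positivity
    · rw [Finsupp.support_nonempty_iff]
      exact fun hc ↦ h0 (AddMonoidAlgebra.ext (by simp [hc]))
  have hH (σ : Gal(K/ℚ)) (e : K) : H.coeff (σ e) = H.coeff e := by
    let τ := AddMonoidAlgebra.mapDomainRingEquiv ℤ (σ.symm : K ≃+ K)
    have hτ (x : AddMonoidAlgebra ℤ K) (e : K) : (τ x).coeff e = x.coeff (σ e) := by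
      rw [AddMonoidAlgebra.coeff_mapDomainRingEquiv]
      rfl
    rw [← hτ, map_mul]
    congr 3
    · ext e
      rw [hτ, hh]
    · ext e
      rw [hτ, hν, hν, ← map_neg, hh]
  refine int_add_sum_exp_ne_zero φ (H.coeff.support.erase 0) (by simp) H.coeff ?_ hH hw ?_
  · intro σ e he
    simpa [hH] using he
  · rw [← AddMonoidAlgebra.sum_coeff_single H, Finsupp.sum, map_sum] at hEH
    rw [← hEH, ← Finset.add_sum_erase _ _ (Finsupp.mem_support_iff.2 hw)]
    simp [hE]

/-- The Hermite–Lindemann theorem. -/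
theorem not_isAlgebraic_exp {α : ℂ} (hα : IsAlgebraic ℚ α) (h0 : α ≠ 0) :
    ¬IsAlgebraic ℚ (Complex.exp α) := by
  intro hβ
  let K := IntermediateField.adjoin ℚ ((minpoly ℚ α).rootSet ℂ)
  have : (minpoly ℚ α).IsSplittingField ℚ K :=
    IntermediateField.adjoin_rootSet_isSplittingField (IsAlgClosed.splits _)
  have : FiniteDimensional ℚ K := Polynomial.IsSplittingField.finiteDimensional K (minpoly ℚ α)
  have : IsGalois ℚ K := IsGalois.of_separable_splitting_field
    (minpoly.irreducible hα.isIntegral).separable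
  have hαK : α ∈ K := IntermediateField.subset_adjoin _ _ <| by
    simp [mem_rootSet, minpoly.ne_zero hα.isIntegral]
  obtain ⟨q, hq, hqβ⟩ : IsAlgebraic ℤ (Complex.exp α) :=
    (IsFractionRing.isAlgebraic_iff ℤ ℚ ℂ).2 hβ
  let a : K := ⟨α, hαK⟩
  have ha : a ≠ 0 := fun h ↦ h0 (congrArg Subtype.val h)
  let φ : K →+* ℂ := algebraMap K ℂ
  let E : AddMonoidAlgebra ℤ K →ₐ[ℤ] ℂ := AddMonoidAlgebra.lift ℤ ℂ K
    { toFun := fun e ↦ Complex.exp (φ e.toAdd)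
      map_one' := by simp
      map_mul' := fun x y ↦ by simp [Complex.exp_add] }
  have hE (e : K) (n : ℤ) : E (.single e n) = n * Complex.exp (φ e) := by
    simp [E, AddMonoidAlgebra.lift_single]
  let t (e : K) : AddMonoidAlgebra ℤ K := aeval (AddMonoidAlgebra.single e (1 : ℤ)) q
  have ht (e : K) (he : e ≠ 0) : t e ≠ 0 := by
    intro h
    apply hq
    ext k
    have hk := congrArg (fun x ↦ x.coeff (k • e)) h
    by_cases hkq : q.natDegree < k
    · simp [coeff_eq_zero_of_natDegree_lt hkq]
    simpa [t, not_lt.1 hkq, aeval_eq_sum_range, AddMonoidAlgebra.single_pow,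
      AddMonoidAlgebra.coeff_sum, Finsupp.finsetSum_apply, Finsupp.single_apply, he, eq_comm] using hk
  refine lift_exp_ne_zero_of_fixed φ E.toRingHom hE (h := ∏ σ : Gal(K/ℚ), t (σ a)) ?_ ?_ ?_
  · exact Finset.prod_ne_zero_iff.2 fun σ _ ↦ ht _ (by simpa using ha)
  · intro σ e
    let τ := AddMonoidAlgebra.mapDomainRingEquiv ℤ (σ.symm : K ≃+ K)
    have hτ (x : AddMonoidAlgebra ℤ K) (e : K) : (τ x).coeff e = x.coeff (σ e) := by
      rw [AddMonoidAlgebra.coeff_mapDomainRingEquiv]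
      rfl
    have hτt (e : K) : τ (t e) = t (σ.symm e) := by
      have := aeval_algHom_apply τ.toRingHom.toIntAlgHom (AddMonoidAlgebra.single e (1 : ℤ)) q
      refine this.symm.trans ?_
      simp [t, τ]
      rfl
    rw [← hτ, map_prod]
    congr 2
    refine Fintype.prod_equiv (Equiv.mulLeft σ.symm) _ _ fun ρ ↦ ?_
    rw [hτt]
    rfl
  · have : E (t a) = 0 := by
      rw [← aeval_algHom_apply, hE]
      simpa [a, φ] using hqβ
    rw [AlgHom.toRingHom_eq_coe, RingHom.coe_coe, map_prod]
    exact Finset.prod_eq_zero (Finset.mem_univ 1) this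

theorem aevalAeval_eq_eval₂ {A L : Type*} [CommRing A] [CommRing L] [Algebra A L] (x y : L)
    (g : A[X][X]) : aevalAeval x y g = eval₂ (aeval x : A[X] →ₐ[A] L).toRingHom y g := by
  induction g using Polynomial.induction_on' with
  | add p q hp hq => rw [map_add, hp, hq, eval₂_add]
  | monomial n r => simp [← C_mul_X_pow_eq_monomial]

theorem exists_dvd_of_transcendental_left {A L : Type*} [CommRing A] [IsDomain A]
    [UniqueFactorizationMonoid A] [Field L] [Algebra A L] {x y : L} (hx : Transcendental A x)
    {f : A[X][X]} (hf : f ≠ 0) (hfxy : aevalAeval x y f = 0) :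
    ∃ π : A[X][X], aevalAeval x y π = 0 ∧ ∀ g : A[X][X], aevalAeval x y g = 0 → π ∣ g := by
  obtain ⟨π, hπ, hπxy⟩ : ∃ π : A[X][X], Irreducible π ∧ aevalAeval x y π = 0 := by
    induction f using WfDvdMonoid.induction_on_irreducible with
    | zero => exact absurd rfl hf
    | unit u hu => exact absurd hfxy (hu.map (aevalAeval x y)).ne_zero
    | mul a i ha hi ih =>
      rw [map_mul, mul_eq_zero] at hfxy
      exact hfxy.elim (fun h ↦ ⟨i, hi, h⟩) (ih ha)
  let K := FractionRing A[X]
  have hinj : Function.Injective (aeval x : A[X] →ₐ[A] L).toRingHom :=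
    transcendental_iff_injective.1 hx
  let ψ : K →+* L := IsFractionRing.lift hinj
  have hψ (g : A[X][X]) : eval₂ ψ y (g.map (algebraMap A[X] K)) = aevalAeval x y g := by
    rw [aevalAeval_eq_eval₂, eval₂_map]
    congr 1
    exact RingHom.ext fun r ↦ IsFractionRing.lift_algebraMap hinj r
  have hdeg : π.natDegree ≠ 0 := by
    intro h
    obtain ⟨r, rfl⟩ := natDegree_eq_zero.1 h
    rw [aevalAeval_C] at hπxy
    exact hπ.ne_zero (by rw [transcendental_iff.1 hx r hπxy, C_0])
  have hprim := hπ.isPrimitive hdeg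
  have hirr := (hprim.irreducible_iff_irreducible_map_fraction_map (K := K)).1 hπ
  refine ⟨π, hπxy, fun g hg ↦ hprim.dvd_of_fraction_map_dvd_fraction_map (K := K) ?_⟩
  by_contra hdvd
  obtain ⟨u, v, huv⟩ := (hirr.coprime_iff_not_dvd).2 hdvd
  have := congrArg (eval₂ ψ y) huv
  rw [eval₂_add, eval₂_mul, eval₂_mul, hψ, hψ, hπxy, hg, eval₂_one] at this
  simp at this

theorem C_X_sub_C_dvd_of_transcendental_right {A L : Type*} [CommRing A] [CommRing L]
    [Algebra A L] {a : A} {y : L} (hy : Transcendental A y) {g : A[X][X]}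
    (hg : aevalAeval (algebraMap A L a) y g = 0) : C (X - C a) ∣ g := by
  have h : aeval y (g.map (evalRingHom a)) = 0 := by
    rw [← hg, aevalAeval_eq_eval₂, aeval_def, eval₂_map]
    congr 1
    ext <;> simp
  rw [C_dvd_iff_dvd_coeff]
  intro k
  rw [dvd_iff_isRoot]
  have := congrArg (fun p ↦ p.coeff k) (transcendental_iff.1 hy _ h)
  simpa using this

/-- The derivation `∂/∂x + i y ∂/∂y` of `A[x][y]`. -/
noncomputable def expDeriv {A : Type*} [CommRing A] (i : A) : Derivation ℤ A[X][X] A[X][X] :=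
  letI : Differential A[X] := ⟨derivative'.restrictScalars ℤ⟩
  Differential.implicitDeriv (C (C i) * X)

theorem coeff_expDeriv {A : Type*} [CommRing A] (i : A) (g : A[X][X]) (k : ℕ) :
    (expDeriv i g).coeff k = derivative (g.coeff k) + C (i * k) * g.coeff k := by
  let _ : Differential A[X] := ⟨derivative'.restrictScalars ℤ⟩
  have h : (expDeriv i g).coeff k =
      derivative (g.coeff k) + (C (C i) * X * derivative g).coeff k := rfl
  rw [h, mul_assoc, coeff_C_mul]
  cases k with
  | zero => simp
  | succ k =>
    rw [coeff_X_mul, coeff_derivative]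
    simp only [map_mul, Nat.cast_add, Nat.cast_one, map_add, map_natCast, map_one]
    ring

theorem expDeriv_monomial {A : Type*} [CommRing A] (i : A) (n : ℕ) (r : A[X]) :
    expDeriv i (monomial n r) = monomial n (derivative r + C (i * n) * r) := by
  ext1 k
  rw [coeff_expDeriv, coeff_monomial, coeff_monomial]
  split_ifs with h <;> simp [h]

theorem hasDerivAt_aevalAeval_exp {A : Type*} [CommRing A] [Algebra A ℂ] {i : A}
    (hi : algebraMap A ℂ i = Complex.I) (g : A[X][X]) (x : ℂ) :
    HasDerivAt (fun z ↦ aevalAeval z (Complex.exp (Complex.I * z)) g)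
      (aevalAeval x (Complex.exp (Complex.I * x)) (expDeriv i g)) x := by
  induction g using Polynomial.induction_on' with
  | add p q hp hq =>
    simp only [map_add]
    exact hp.add hq
  | monomial n r =>
    rw [expDeriv_monomial]
    have hexp : HasDerivAt (fun z ↦ Complex.exp (Complex.I * z) ^ n)
        (n * Complex.I * Complex.exp (Complex.I * x) ^ n) x := by
      simp only [← Complex.exp_nat_mul, ← mul_assoc]
      convert! ((hasDerivAt_id x).const_mul (n * Complex.I)).cexp using 1
      simp [mul_comm]
    have hr := (Polynomial.hasDerivAt_aeval r x).mul hexp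
    simp only [aevalAeval_eq_eval₂, eval₂_monomial]
    convert! hr using 1
    simp [hi]
    ring

theorem eq_zero_of_dvd_expDeriv {A L : Type*} [CommRing A] [IsDomain A] [CharZero A] [CommRing L]
    [IsDomain L] [Algebra A L] [FaithfulSMul A L] {i : A} (hi : i ≠ 0) {x y : L} (hy : y ≠ 0)
    {π : A[X][X]} (hπ : π ∣ expDeriv i π) (hxy : aevalAeval x y π = 0) : π = 0 := by
  by_contra h0
  obtain ⟨q, hq⟩ := hπ
  obtain ⟨r, rfl⟩ : ∃ r, q = C r := by
    by_cases hq0 : q = 0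
    · exact ⟨0, by simp [hq0]⟩
    have hdeg : (expDeriv i π).natDegree ≤ π.natDegree := by
      rw [natDegree_le_iff_coeff_eq_zero]
      intro k hk
      rw [coeff_expDeriv, coeff_eq_zero_of_natDegree_lt hk]
      simp
    rw [hq, natDegree_mul h0 hq0] at hdeg
    exact ⟨_, eq_C_of_natDegree_eq_zero (by omega)⟩
  have hcoeff (k : ℕ) : derivative (π.coeff k) + C (i * k) * π.coeff k = π.coeff k * r := by
    rw [← coeff_expDeriv, hq, coeff_mul_C]
  have key (k : ℕ) (hk : π.coeff k ≠ 0) : r = C (i * k) ∧ ∃ c, π.coeff k = C c := by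
    have h1 : derivative (π.coeff k) = π.coeff k * (r - C (i * k)) := by
      linear_combination hcoeff k
    have h2 : r - C (i * k) = 0 := by
      by_contra hne
      have := degree_derivative_lt hk
      rw [h1, degree_mul, degree_eq_natDegree hk, degree_eq_natDegree hne] at this
      norm_cast at this
      omega
    rw [h2, mul_zero] at h1
    exact ⟨sub_eq_zero.1 h2, _, eq_C_of_derivative_eq_zero h1⟩
  obtain ⟨hr, c, hc⟩ := key π.natDegree (leadingCoeff_ne_zero.2 h0)
  have hπ : π = monomial π.natDegree (C c) := by
    ext1 k
    rw [coeff_monomial]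
    split_ifs with h
    · rw [← h, hc]
    · by_contra hk
      have := C_injective (hr.symm.trans (key k hk).1)
      exact h (by exact_mod_cast mul_left_cancel₀ hi this)
  rw [hπ, aevalAeval_eq_eval₂, eval₂_monomial] at hxy
  have hc0 : c = 0 := by simpa [hy] using hxy
  rw [hc0, C_0, monomial_zero_right] at hπ
  exact h0 hπ

theorem stmt_3 (f : MvPolynomial (Fin 2) AlgNum) (hsf : Squarefree f) :
    ∀ x : ℂ, x ≠ 0 → ¬(evalExp f x = 0 ∧ deriv (evalExp f) x = 0) := by
  rintro x hx ⟨hF, hF'⟩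
  have hfield : IsField AlgNum := isField_of_isIntegral_of_isField' (Field.toIsField ℚ)
  have : UniqueFactorizationMonoid AlgNum :=
    letI := hfield.toField
    inferInstance
  let i : AlgNum := ⟨Complex.I, Complex.isIntegral_rat_I⟩
  have hi : i ≠ 0 := fun h ↦ Complex.I_ne_zero (congrArg Subtype.val h)
  let e := Polynomial.Bivariate.equivMvPolynomial AlgNum
  set f' := e.symm f with hf'
  have heval (g : AlgNum[X][X]) (z : ℂ) :
      evalExp (e g) z = aevalAeval z (Complex.exp (Complex.I * z)) g := by
    let y := Complex.exp (Complex.I * z)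
    have : ((MvPolynomial.aeval ![z, y]).comp e.toAlgHom : AlgNum[X][X] →ₐ[AlgNum] ℂ) =
        aevalAeval z y := by
      ext <;> simp [e, y]
    rw [← this, evalExp, MvPolynomial.eval_map]
    rfl
  have hfun : evalExp f = fun z ↦ aevalAeval z (Complex.exp (Complex.I * z)) f' := by
    ext z
    rw [← heval, hf', e.apply_symm_apply]
  have hsf' : Squarefree f' := fun a ha ↦ by
    have h := hsf (e a) (by rw [← map_mul, ← e.apply_symm_apply f]; exact map_dvd e ha)
    exact (MulEquiv.isUnit_map e).1 h
  rw [hfun, (hasDerivAt_aevalAeval_exp (i := i) rfl f' x).deriv] at hF'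
  rw [hfun] at hF
  beta_reduce at hF
  set y := Complex.exp (Complex.I * x) with hy
  obtain ⟨π, hπ, hdvd⟩ : ∃ π : AlgNum[X][X], aevalAeval x y π = 0 ∧
      ∀ g : AlgNum[X][X], aevalAeval x y g = 0 → π ∣ g := by
    by_cases hxa : Transcendental AlgNum x
    · exact exists_dvd_of_transcendental_left hxa hsf'.ne_zero hF
    have hxa : IsAlgebraic ℚ x := (not_not.1 hxa).restrictScalars ℚ
    have hya : Transcendental AlgNum y := fun h ↦ not_isAlgebraic_exp
      (Complex.isIntegral_rat_I.isAlgebraic.mul hxa) (mul_ne_zero Complex.I_ne_zero hx)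
      (h.restrictScalars ℚ)
    let a : AlgNum := ⟨x, hxa.isIntegral⟩
    refine ⟨C (X - C a), ?_, fun g hg ↦ C_X_sub_C_dvd_of_transcendental_right hya hg⟩
    rw [aevalAeval_C]
    simp [a]
  obtain ⟨h, hh⟩ := hdvd f' hF
  have hπ0 : π ≠ 0 := by
    rintro rfl
    exact hsf'.ne_zero (by rw [hh, zero_mul])
  rw [hh, Derivation.leibniz, map_add, smul_eq_mul, smul_eq_mul, map_mul, map_mul, hπ, zero_mul,
    zero_add, mul_eq_zero] at hF'
  rcases hF' with h1 | h1
  · obtain ⟨k, hk⟩ := hdvd h h1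
    have hu := hsf' π ⟨k, by rw [hh, hk, mul_assoc]⟩
    exact (hu.map (aevalAeval x y)).ne_zero hπ
  · exact hπ0 (eq_zero_of_dvd_expDeriv hi (Complex.exp_ne_zero _) (hdvd _ h1) hπ)
end
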